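/- (Le Cam's third lemma under LAN.) Suppose the LAN condition holds, and let S_n : Ω_n → ℝ be measurable maps such that the law of the pair (X_n, S_n) under P_{n,0} converges weakly on ℝ² to a probability measure μ₀. Then for every θ ∈ Θ the law of (X_n, S_n) under P_{n,θ} converges weakly on ℝ² to the measure μ_θ which is absolutely continuous with respect to μ₀ with density dμ_θ/dμ₀(x, y) = exp(θ·x − θ²σ²/2). -/

import Mathlib

open MeasureTheory ProbabilityTheory Filter Topology

/-- Weak convergence of a sequence of measures: convergence of the integrals of all bounded
continuous functions. -/
def WeaklyTendsTo {α : Type*} [MeasurableSpace α] [TopologicalSpace α]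
    (μ : ℕ → Measure α) (ν : Measure α) : Prop :=
  ∀ g : BoundedContinuousFunction α ℝ,
    Tendsto (fun n => ∫ x, g x ∂(μ n)) atTop (𝓝 (∫ x, g x ∂ν))

/-- A bounded Lipschitz minorant of `exp` vanishing at `0`. -/
noncomputable def truncExp (k : ℕ) (z : ℝ) : ℝ :=
  min (Real.exp (min z k)) (k * |z|)

lemma truncExp_nonneg (k : ℕ) (z : ℝ) : 0 ≤ truncExp k z :=
  le_min (Real.exp_pos _).le (by positivity)

lemma truncExp_le_exp (k : ℕ) (z : ℝ) : truncExp k z ≤ Real.exp z :=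
  (min_le_left _ _).trans (Real.exp_le_exp.2 (min_le_left _ _))

lemma truncExp_le (k : ℕ) (z : ℝ) : truncExp k z ≤ Real.exp k :=
  (min_le_left _ _).trans (Real.exp_le_exp.2 (min_le_right _ _))

lemma continuous_truncExp (k : ℕ) : Continuous (truncExp k) := by
  unfold truncExp
  fun_prop

lemma exp_sub_exp_le_of_le {a b k : ℝ} (ha : a ≤ k) :
    Real.exp a - Real.exp b ≤ Real.exp k * |a - b| := by
  have h1 : Real.exp b = Real.exp a * Real.exp (b - a) := by
    rw [← Real.exp_add]; congr 1; ring
  have h2 := Real.add_one_le_exp (b - a)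
  calc Real.exp a - Real.exp b ≤ Real.exp a * (a - b) := by
        rw [h1]; nlinarith [Real.exp_pos a]
    _ ≤ Real.exp a * |a - b| := by gcongr; exact le_abs_self _
    _ ≤ Real.exp k * |a - b| := by gcongr

lemma truncExp_le_add (k : ℕ) (z w : ℝ) :
    truncExp k z ≤ truncExp k w + Real.exp k * |z - w| := by
  have hk : (k : ℝ) ≤ Real.exp k := by linarith [Real.add_one_le_exp (k : ℝ)]
  unfold truncExp
  rw [min_add]
  refine min_le_min ?_ ?_
  · have h1 := exp_sub_exp_le_of_le (b := min w k) (min_le_right z (k : ℝ))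
    have h2 : |min z (k : ℝ) - min w k| ≤ |z - w| := by
      simpa using abs_min_sub_min_le_max z (k : ℝ) w k
    nlinarith [Real.exp_pos (k : ℝ)]
  · have h1 : |z| ≤ |w| + |z - w| := by
      simpa using abs_add_le w (z - w)
    have h2 : (k : ℝ) * |z - w| ≤ Real.exp k * |z - w| := by gcongr
    have h3 : (0 : ℝ) ≤ k := by positivity
    nlinarith

/-- The convention `Real.log 0 = 0` is harmless here because `truncExp k 0 = 0`. -/
lemma truncExp_log_le (k : ℕ) {l : ℝ} (hl : 0 ≤ l) : truncExp k (Real.log l) ≤ l := by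
  rcases hl.eq_or_lt with rfl | h
  · simp [truncExp]
  · exact (truncExp_le_exp _ _).trans (Real.exp_log h).le

lemma tendsto_truncExp {z : ℝ} (hz : z ≠ 0) :
    Tendsto (fun k => truncExp k z) atTop (𝓝 (Real.exp z)) := by
  refine tendsto_const_nhds.congr' ?_
  obtain ⟨N, hN⟩ := exists_nat_ge (max z (Real.exp z / |z|))
  filter_upwards [eventually_ge_atTop N] with k hk
  have hk' : (N : ℝ) ≤ k := by exact_mod_cast hk
  have h1 : z ≤ k := (le_max_left _ _).trans (hN.trans hk')
  have h2 : Real.exp z / |z| ≤ k := (le_max_right _ _).trans (hN.trans hk')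
  rw [div_le_iff₀ (abs_pos.2 hz)] at h2
  rw [truncExp, min_eq_left h1, min_eq_left h2]

lemma integral_mul_rnDeriv_le {Ω : Type*} [MeasurableSpace Ω] (μ ν : Measure Ω)
    [IsFiniteMeasure μ] [IsFiniteMeasure ν] {G : Ω → ℝ} (hG : Measurable G)
    {M : ℝ} (hG0 : ∀ ω, 0 ≤ G ω) (hGM : ∀ ω, G ω ≤ M) :
    ∫ ω, G ω * (μ.rnDeriv ν ω).toReal ∂ν ≤ ∫ ω, G ω ∂μ := by
  have hint : Integrable G μ :=
    Integrable.of_bound hG.aestronglyMeasurable M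
      (ae_of_all _ fun ω => by rw [Real.norm_of_nonneg (hG0 ω)]; exact hGM ω)
  have h := integral_mono_measure (Measure.withDensity_rnDeriv_le μ ν)
    (ae_of_all _ hG0) hint
  rw [integral_withDensity_eq_integral_toReal_smul (Measure.measurable_rnDeriv _ _)
    (Measure.rnDeriv_lt_top _ _)] at h
  simpa [smul_eq_mul, mul_comm] using h

lemma integral_mul_truncExp_le {Ω : Type*} [MeasurableSpace Ω] (μ ν : Measure Ω)
    [IsProbabilityMeasure μ] [IsProbabilityMeasure ν] {G Z : Ω → ℝ} (hG : Measurable G)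
    (hZ : Measurable Z) {M : ℝ} (hG0 : ∀ ω, 0 ≤ G ω) (hGM : ∀ ω, G ω ≤ M) (k : ℕ)
    {ε : ℝ} (hε : 0 < ε) :
    ∫ ω, G ω * truncExp k (Z ω) ∂ν - M * Real.exp k * ε
      - M * Real.exp k *
        (ν {ω | ε ≤ |Real.log (μ.rnDeriv ν ω).toReal - Z ω|}).toReal ≤ ∫ ω, G ω ∂μ := by
  set B := {ω | ε ≤ |Real.log (μ.rnDeriv ν ω).toReal - Z ω|}
  have hBm : MeasurableSet B := by
    refine measurableSet_le measurable_const ?_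
    have := (Measure.measurable_rnDeriv μ ν)
    fun_prop
  have hM (ω : Ω) : 0 ≤ M := (hG0 ω).trans (hGM ω)
  have hintL : Integrable (fun ω => G ω * (μ.rnDeriv ν ω).toReal) ν :=
    Measure.integrable_toReal_rnDeriv.bdd_mul hG.aestronglyMeasurable
      (ae_of_all _ fun ω => by rw [Real.norm_of_nonneg (hG0 ω)]; exact hGM ω)
  have hintT : Integrable (fun ω => G ω * truncExp k (Z ω)) ν := by
    refine Integrable.of_bound
      (hG.mul ((continuous_truncExp k).measurable.comp hZ)).aestronglyMeasurable
      (M * Real.exp k) (ae_of_all _ fun ω => ?_)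
    rw [Real.norm_of_nonneg (mul_nonneg (hG0 ω) (truncExp_nonneg _ _))]
    exact mul_le_mul (hGM ω) (truncExp_le _ _) (truncExp_nonneg _ _) (hM ω)
  have hintB : Integrable (B.indicator fun _ => M * Real.exp k) ν :=
    (integrable_const _).indicator hBm
  have hpt : ∀ ω, G ω * truncExp k (Z ω) ≤
      G ω * (μ.rnDeriv ν ω).toReal + M * Real.exp k * ε
        + B.indicator (fun _ => M * Real.exp k) ω := by
    intro ω
    have hL : 0 ≤ (μ.rnDeriv ν ω).toReal := ENNReal.toReal_nonneg
    have hMe : 0 ≤ M * Real.exp k := mul_nonneg (hM ω) (Real.exp_pos _).le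
    by_cases hω : ω ∈ B
    · rw [Set.indicator_of_mem hω]
      have h1 : G ω * truncExp k (Z ω) ≤ M * Real.exp k :=
        mul_le_mul (hGM ω) (truncExp_le _ _) (truncExp_nonneg _ _) (hM ω)
      have h2 := mul_nonneg (hG0 ω) hL
      have h3 := mul_nonneg hMe hε.le
      linarith
    · rw [Set.indicator_of_notMem hω, add_zero]
      have hω' : |Z ω - Real.log (μ.rnDeriv ν ω).toReal| ≤ ε := by
        rw [abs_sub_comm]; exact (not_le.1 hω).le
      have h1 : truncExp k (Z ω) ≤ (μ.rnDeriv ν ω).toReal + Real.exp k * ε :=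
        (truncExp_le_add k _ _).trans (add_le_add (truncExp_log_le k hL) (by gcongr))
      calc G ω * truncExp k (Z ω)
          ≤ G ω * ((μ.rnDeriv ν ω).toReal + Real.exp k * ε) :=
            mul_le_mul_of_nonneg_left h1 (hG0 ω)
        _ = G ω * (μ.rnDeriv ν ω).toReal + G ω * (Real.exp k * ε) := by ring
        _ ≤ G ω * (μ.rnDeriv ν ω).toReal + M * (Real.exp k * ε) := by
            gcongr; exact hGM ω
        _ = _ := by ring
  have h := integral_mono hintT ((hintL.add (integrable_const _)).add hintB) hpt
  rw [integral_add' (hintL.add (integrable_const _)) hintB,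
    integral_add' hintL (integrable_const _), integral_indicator hBm] at h
  simp only [integral_const, measureReal_restrict_apply_univ, probReal_univ, smul_eq_mul,
    one_mul] at h
  rw [Measure.real] at h
  have h' := integral_mul_rnDeriv_le μ ν hG hG0 hGM
  linarith

lemma WeaklyTendsTo.eq_of_map_fst {α : ℕ → Type*} [∀ n, MeasurableSpace (α n)]
    {ν : (n : ℕ) → Measure (α n)} {X S : (n : ℕ) → α n → ℝ}
    (hX : ∀ n, Measurable (X n)) (hS : ∀ n, Measurable (S n))
    {γ : Measure ℝ} [IsFiniteMeasure γ] {μ : Measure (ℝ × ℝ)} [IsFiniteMeasure μ]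
    (h1 : WeaklyTendsTo (fun n => (ν n).map (X n)) γ)
    (h2 : WeaklyTendsTo (fun n => (ν n).map (fun ω => (X n ω, S n ω))) μ) :
    μ.map Prod.fst = γ := by
  refine ext_of_forall_integral_eq_of_IsFiniteMeasure fun f => ?_
  rw [integral_map measurable_fst.aemeasurable f.continuous.aestronglyMeasurable]
  refine tendsto_nhds_unique (h2 (f.compContinuous ⟨Prod.fst, continuous_fst⟩)) ?_
  refine (h1 f).congr fun n => ?_
  rw [integral_map (hX n).aemeasurable f.continuous.aestronglyMeasurable,
    integral_map ((hX n).prodMk (hS n)).aemeasurable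
      (BoundedContinuousFunction.continuous _).aestronglyMeasurable]
  rfl

/-- The lower half of Le Cam's third lemma, for nonnegative test functions. -/
lemma eventually_lt_integral_of_loglikelihood {Ω : ℕ → Type*} [∀ n, MeasurableSpace (Ω n)]
    {E : Type*} [TopologicalSpace E] [MeasurableSpace E] [BorelSpace E]
    {μ ν : (n : ℕ) → Measure (Ω n)} [∀ n, IsProbabilityMeasure (μ n)]
    [∀ n, IsProbabilityMeasure (ν n)] {Y : (n : ℕ) → Ω n → E} (hY : ∀ n, Measurable (Y n))
    {z : E → ℝ} (hz : Continuous z)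
    (hlog : ∀ ε > 0, Tendsto (fun n => ν n {ω | ε ≤
      |Real.log ((μ n).rnDeriv (ν n) ω).toReal - z (Y n ω)|}) atTop (𝓝 0))
    {ρ : Measure E} (hρ : WeaklyTendsTo (fun n => (ν n).map (Y n)) ρ)
    (hz0 : ∀ᵐ p ∂ρ, z p ≠ 0) (hint : Integrable (fun p => Real.exp (z p)) ρ)
    (g : BoundedContinuousFunction E ℝ) (hg : ∀ p, 0 ≤ g p)
    {a : ℝ} (ha : a < ∫ p, g p * Real.exp (z p) ∂ρ) :
    ∀ᶠ n in atTop, a < ∫ ω, g (Y n ω) ∂(μ n) := by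
  have hgM (p : E) : g p ≤ ‖g‖ := (le_abs_self _).trans (g.norm_coe_le_norm p)
  have hlim : Tendsto (fun k : ℕ => ∫ p, g p * truncExp k (z p) ∂ρ) atTop
      (𝓝 (∫ p, g p * Real.exp (z p) ∂ρ)) := by
    refine tendsto_integral_of_dominated_convergence (fun p => ‖g‖ * Real.exp (z p))
      (fun k => ?_) (hint.const_mul _) (fun k => ae_of_all _ fun p => ?_) ?_
    · exact (g.continuous.mul ((continuous_truncExp k).comp hz)).measurable.aestronglyMeasurable
    · rw [Real.norm_of_nonneg (mul_nonneg (hg p) (truncExp_nonneg _ _))]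
      exact mul_le_mul (hgM p) (truncExp_le_exp _ _) (truncExp_nonneg _ _) (norm_nonneg _)
    · filter_upwards [hz0] with p hp
      exact (tendsto_truncExp hp).const_mul _
  obtain ⟨k, hk⟩ := (hlim.eventually_const_lt ha).exists
  set I := ∫ p, g p * truncExp k (z p) ∂ρ
  set C := ‖g‖ * Real.exp k
  have hC : 0 ≤ C := by positivity
  obtain ⟨ε, hε, hCε⟩ : ∃ ε > 0, C * ε < I - a := by
    refine ⟨(I - a) / (C + 1), div_pos (by linarith) (by linarith), ?_⟩
    rw [mul_div_assoc', div_lt_iff₀ (by linarith)]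
    nlinarith
  let f : BoundedContinuousFunction E ℝ :=
    BoundedContinuousFunction.ofNormedAddCommGroup (fun p => g p * truncExp k (z p))
      (g.continuous.mul ((continuous_truncExp k).comp hz)) C fun p => by
        rw [Real.norm_of_nonneg (mul_nonneg (hg p) (truncExp_nonneg _ _))]
        exact mul_le_mul (hgM p) (truncExp_le _ _) (truncExp_nonneg _ _) (norm_nonneg _)
  have hf : Tendsto (fun n => ∫ ω, g (Y n ω) * truncExp k (z (Y n ω)) ∂(ν n)) atTop (𝓝 I) := by
    refine (hρ f).congr fun n => ?_
    rw [integral_map (hY n).aemeasurable f.continuous.measurable.aestronglyMeasurable]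
    rfl
  have hB := (ENNReal.tendsto_toReal ENNReal.zero_ne_top).comp (hlog ε hε)
  have hlow := (hf.sub_const (C * ε)).sub (hB.const_mul C)
  have hlt : a < I - C * ε - C * (0 : ENNReal).toReal := by simp; linarith
  filter_upwards [hlow.eventually_const_lt hlt] with n hn
  exact hn.trans_le (integral_mul_truncExp_le (μ n) (ν n) (g.continuous.measurable.comp (hY n))
    (hz.measurable.comp (hY n)) (fun ω => hg _) (fun ω => hgM _) k hε)

/-- Le Cam's third lemma under LAN. -/
theorem stmt3
    (Θ : Set ℝ) (hΘ0 : (0 : ℝ) ∈ Θ)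
    (Ω : ℕ → Type*) [∀ n, MeasurableSpace (Ω n)]
    (P : (n : ℕ) → ℝ → Measure (Ω n))
    (hP : ∀ n, ∀ θ ∈ Θ, IsProbabilityMeasure (P n θ))
    (σ : ℝ) (hσ : 0 < σ)
    (X : (n : ℕ) → Ω n → ℝ) (hX : ∀ n, Measurable (X n))
    -- LAN (i): the log-likelihood ratio expansion holds in `P n 0`-probability
    (hLAN : ∀ θ ∈ Θ, ∀ ε > 0,
      Tendsto (fun n => P n 0 {ω | ε ≤
          |Real.log ((P n θ).rnDeriv (P n 0) ω).toReal
            - (θ * X n ω - θ ^ 2 * σ ^ 2 / 2)|}) atTop (𝓝 0))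
    -- LAN (ii): the central sequence is asymptotically `N(0, σ²)` under `P n 0`
    (hCLT : WeaklyTendsTo (fun n => (P n 0).map (X n))
      (gaussianReal 0 ⟨σ ^ 2, sq_nonneg σ⟩))
    (S : (n : ℕ) → Ω n → ℝ) (hS : ∀ n, Measurable (S n))
    (μ₀ : Measure (ℝ × ℝ)) (hμ₀ : IsProbabilityMeasure μ₀)
    (hconv0 : WeaklyTendsTo (fun n => (P n 0).map (fun ω => (X n ω, S n ω))) μ₀) :
    ∀ θ ∈ Θ,
      WeaklyTendsTo (fun n => (P n θ).map (fun ω => (X n ω, S n ω)))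
        (μ₀.withDensity
          (fun p => ENNReal.ofReal (Real.exp (θ * p.1 - θ ^ 2 * σ ^ 2 / 2)))) := by
  intro θ hθ
  have := fun n => hP n 0 hΘ0
  have := fun n => hP n θ hθ
  rcases eq_or_ne θ 0 with rfl | hθ0
  · simpa using hconv0
  have hY (n : ℕ) : Measurable fun ω => (X n ω, S n ω) := (hX n).prodMk (hS n)
  set z : ℝ × ℝ → ℝ := fun p => θ * p.1 - θ ^ 2 * σ ^ 2 / 2 with hz_def
  have hz : Continuous z := by fun_prop
  obtain ⟨v, hvσ, hCLT'⟩ : ∃ v : NNReal, (v : ℝ) = σ ^ 2 ∧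
      WeaklyTendsTo (fun n => (P n 0).map (X n)) (gaussianReal 0 v) := ⟨_, rfl, hCLT⟩
  have hv : v ≠ 0 := by
    rintro rfl
    exact (pow_pos hσ 2).ne hvσ
  have hfst := WeaklyTendsTo.eq_of_map_fst hX hS hCLT' hconv0
  have hexp (x : ℝ) : Real.exp (θ * x - θ ^ 2 * σ ^ 2 / 2)
      = Real.exp (-(θ ^ 2 * σ ^ 2 / 2)) * Real.exp (θ * x) := by
    rw [← Real.exp_add]; ring_nf
  have hint : Integrable (fun p => Real.exp (z p)) μ₀ := by
    have h : Integrable (fun x : ℝ => Real.exp (θ * x - θ ^ 2 * σ ^ 2 / 2))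
        (μ₀.map Prod.fst) := by
      rw [hfst]
      simp_rw [hexp]
      exact (integrable_exp_mul_gaussianReal θ).const_mul _
    exact h.comp_measurable measurable_fst
  have hone : ∫ p, Real.exp (z p) ∂μ₀ = 1 := by
    have h : ∫ x, Real.exp (θ * x - θ ^ 2 * σ ^ 2 / 2) ∂(μ₀.map Prod.fst) = 1 := by
      rw [hfst]
      simp_rw [hexp]
      rw [integral_const_mul]
      have := congrFun (mgf_id_gaussianReal (μ := 0) (v := v)) θ
      simp only [mgf, id] at this
      rw [this, ← Real.exp_add, Real.exp_eq_one_iff]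
      rw [hvσ]
      ring
    rwa [integral_map measurable_fst.aemeasurable
      (by fun_prop : Continuous _).aestronglyMeasurable] at h
  have hz0 : ∀ᵐ p ∂μ₀, z p ≠ 0 := by
    have := nullSingletonClass_gaussianReal (μ := 0) hv
    have h : ∀ᵐ x ∂(μ₀.map Prod.fst), x ≠ θ * σ ^ 2 / 2 := by
      rw [hfst]
      exact compl_mem_ae_iff.2 (measure_singleton _)
    filter_upwards [ae_of_ae_map measurable_fst.aemeasurable h] with p hp hp0
    refine hp (mul_left_cancel₀ hθ0 ?_)
    rw [hz_def] at hp0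
    linear_combination hp0
  have key (g : BoundedContinuousFunction (ℝ × ℝ) ℝ) (hg : ∀ p, 0 ≤ g p) (a : ℝ)
      (ha : a < ∫ p, g p * Real.exp (z p) ∂μ₀) :
      ∀ᶠ n in atTop, a < ∫ ω, g (X n ω, S n ω) ∂(P n θ) :=
    eventually_lt_integral_of_loglikelihood (ν := fun n => P n 0) hY hz (hLAN θ hθ) hconv0
      hz0 hint g hg ha
  intro g
  have hgabs (p : ℝ × ℝ) : |g p| ≤ ‖g‖ := g.norm_coe_le_norm p
  have hgint : Integrable (fun p => g p * Real.exp (z p)) μ₀ :=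
    hint.bdd_mul g.continuous.aestronglyMeasurable (ae_of_all _ g.norm_coe_le_norm)
  have hgintP (n : ℕ) : Integrable (fun ω => g (X n ω, S n ω)) (P n θ) :=
    Integrable.of_bound (g.continuous.measurable.comp (hY n)).aestronglyMeasurable ‖g‖
      (ae_of_all _ fun ω => g.norm_coe_le_norm _)
  have hlim : ∫ p, g p ∂(μ₀.withDensity fun p => ENNReal.ofReal (Real.exp (z p)))
      = ∫ p, g p * Real.exp (z p) ∂μ₀ := by
    rw [integral_withDensity_eq_integral_toReal_smul (by fun_prop) (by simp)]
    simp [ENNReal.toReal_ofReal, Real.exp_nonneg, mul_comm]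
  rw [hlim]
  refine Tendsto.congr (f₁ := fun n => ∫ ω, g (X n ω, S n ω) ∂(P n θ))
    (fun n => (integral_map (hY n).aemeasurable g.continuous.aestronglyMeasurable).symm) ?_
  refine tendsto_order.2 ⟨fun a ha => ?_, fun a ha => ?_⟩
  · have h := key (BoundedContinuousFunction.const _ ‖g‖ + g)
      (fun p => by
        simp only [BoundedContinuousFunction.coe_add, Pi.add_apply,
          BoundedContinuousFunction.const_apply]
        linarith [neg_le_of_abs_le (hgabs p)]) (‖g‖ + a)
      (by
        simp only [BoundedContinuousFunction.coe_add, Pi.add_apply,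
          BoundedContinuousFunction.const_apply, add_mul]
        rw [integral_add (hint.const_mul _) hgint, integral_const_mul, hone]
        linarith)
    filter_upwards [h] with n hn
    simp only [BoundedContinuousFunction.coe_add, Pi.add_apply,
      BoundedContinuousFunction.const_apply] at hn
    rw [integral_add (integrable_const _) (hgintP n)] at hn
    simp at hn
    exact hn
  · have h := key (BoundedContinuousFunction.const _ ‖g‖ - g)
      (fun p => by
        simp only [BoundedContinuousFunction.coe_sub, Pi.sub_apply,
          BoundedContinuousFunction.const_apply]
        linarith [le_of_abs_le (hgabs p)]) (‖g‖ - a)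
      (by
        simp only [BoundedContinuousFunction.coe_sub, Pi.sub_apply,
          BoundedContinuousFunction.const_apply, sub_mul]
        rw [integral_sub (hint.const_mul _) hgint, integral_const_mul, hone]
        linarith)
    filter_upwards [h] with n hn
    simp only [BoundedContinuousFunction.coe_sub, Pi.sub_apply,
      BoundedContinuousFunction.const_apply] at hn
    rw [integral_sub (integrable_const _) (hgintP n)] at hn
    simp at hn
    exact hn
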